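/- arXiv:2112.10923 — 2 statements merged into one kernel-verified Lean document; each statement's English description precedes it below -/
import Mathlib

section
/- Let k ≥ 1 be a natural number. The constant (2k−1)²/4 in the weighted Hardy inequality on ℤ is sharp: for every real c > (2k−1)²/4 there exists a finitely supported function u : ℤ → ℂ with u(0) = 0 such that ∑_{n ∈ ℤ} |u(n) − u(n−1)|² (n − 1/2)^{2k} < c · ∑_{n ∈ ℤ} |u(n)|² n^{2k−2}. -/
open scoped BigOperators

lemma wh_bernoulli (a x : ℝ) (ha : 0 < a) (hx : 0 < x) : 1 - a * x ≤ (1 + x) ^ (-a) := by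
  have h1 : (0:ℝ) < 1 + x := by linarith
  rw [Real.rpow_def_of_pos h1]
  have h2 : Real.log (1 + x) ≤ x := by
    have := Real.log_le_sub_one_of_pos h1
    linarith
  have h3 := Real.add_one_le_exp (Real.log (1 + x) * -a)
  nlinarith

lemma wh_diff (k : ℕ) (hk : 1 ≤ k) (i : ℝ) (hi : 0 < i) :
    ((i + 1) ^ (-((k:ℝ) - 1/2)) - i ^ (-((k:ℝ) - 1/2))) ^ 2 * (i + 1/2) ^ (2*k) ≤
      ((k:ℝ) - 1/2) ^ 2 * ((1 + 1 / i) * (1 + (1/2) / i) ^ (2*k)) / (i + 1) := by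
  have hk' : (1:ℝ) ≤ k := by exact_mod_cast hk
  set a : ℝ := (k:ℝ) - 1/2 with ha
  have hapos : 0 < a := by linarith
  have e1 : (i + 1) ^ (-a) = i ^ (-a) * (1 + 1 / i) ^ (-a) := by
    rw [← Real.mul_rpow hi.le (by positivity)]
    congr 1
    field_simp
  have hb := wh_bernoulli a (1 / i) hapos (by positivity)
  have hle1 : (1 + 1 / i) ^ (-a) ≤ 1 :=
    Real.rpow_le_one_of_one_le_of_nonpos (by have : 0 < 1 / i := by positivity
                                             linarith) (by linarith)
  have hsq : ((1 + 1 / i) ^ (-a) - 1) ^ 2 ≤ (a * (1 / i)) ^ 2 := by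
    apply sq_le_sq'
    · linarith
    · have : 0 < a * (1 / i) := by positivity
      linarith
  have e2 : (i ^ (-a)) ^ 2 = i / i ^ (2 * k) := by
    rw [← Real.rpow_natCast, ← Real.rpow_mul hi.le, ← Real.rpow_natCast i (2*k)]
    rw [show i / i ^ ((2 * k : ℕ):ℝ) = i ^ (1:ℝ) / i ^ ((2 * k : ℕ):ℝ) by rw [Real.rpow_one],
      ← Real.rpow_sub hi]
    congr 1
    push_cast
    rw [ha]; ring
  have e3 : (1 + (1/2) / i) ^ (2*k) = (i + 1/2) ^ (2*k) / i ^ (2*k) := by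
    rw [← div_pow]; congr 1; field_simp
  calc _ = (i ^ (-a)) ^ 2 * ((1 + 1 / i) ^ (-a) - 1) ^ 2 * (i + 1/2) ^ (2*k) := by
        rw [e1]; ring
    _ ≤ (i ^ (-a)) ^ 2 * (a * (1 / i)) ^ 2 * (i + 1/2) ^ (2*k) := by gcongr
    _ = _ := by
        rw [e2, e3]
        have : i + 1 ≠ 0 := by positivity
        field_simp

lemma wh_limit (k : ℕ) (a d : ℝ) (hd : 0 < d) :
    ∃ M : ℕ, ∀ i : ℕ, M ≤ i →
      a ^ 2 * ((1 + 1 / (i:ℝ)) * (1 + (1/2) / (i:ℝ)) ^ (2*k)) ≤ a ^ 2 + d := by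
  have h1 := tendsto_const_div_atTop_nhds_zero_nat (1:ℝ)
  have h2 := tendsto_const_div_atTop_nhds_zero_nat (1/2:ℝ)
  have h3 := (((h1.const_add 1).mul ((h2.const_add 1).pow (2*k))).const_mul (a^2))
  simp only [add_zero, one_pow, mul_one] at h3
  have h4 := h3.eventually_le_const (show a ^ 2 < a ^ 2 + d by linarith)
  exact Filter.eventually_atTop.1 h4

lemma wh_sum (g h : ℕ → ℝ) (M : ℕ) (hh : ∀ i, 0 ≤ h i) (hgh : ∀ i, M ≤ i → g i ≤ h i) (N : ℕ) :
    ∑ i ∈ Finset.range N, g i ≤ ∑ i ∈ Finset.range M, |g i| + ∑ i ∈ Finset.range N, h i := by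
  have h1 : ∑ i ∈ Finset.range N, g i ≤
      ∑ i ∈ Finset.range N, ((if i < M then |g i| else 0) + h i) := by
    apply Finset.sum_le_sum
    intro i _
    split_ifs with hi
    · linarith [le_abs_self (g i), hh i]
    · linarith [hgh i (not_lt.1 hi)]
  rw [Finset.sum_add_distrib, ← Finset.sum_filter] at h1
  have h2 : ∑ i ∈ (Finset.range N).filter (· < M), |g i| ≤ ∑ i ∈ Finset.range M, |g i| := by
    apply Finset.sum_le_sum_of_subset_of_nonneg
    · intro i hi
      simp at hi ⊢
      exact hi.2
    · intros; positivity
  linarith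

lemma wh_sqrt (N : ℕ) : ∑ i ∈ Finset.range N, 1 / √((i:ℝ) + 1) ≤ 2 * √(N:ℝ) := by
  induction N with
  | zero => simp
  | succ n ih =>
    rw [Finset.sum_range_succ]
    push_cast
    have hx : 0 < √((n:ℝ) + 1) := Real.sqrt_pos.2 (by positivity)
    have hs : √((n:ℝ) + 1) ^ 2 = n + 1 := Real.sq_sqrt (by positivity)
    have ht : √(n:ℝ) ^ 2 = n := Real.sq_sqrt (by positivity)
    have : 1 / √((n:ℝ) + 1) ≤ 2 * √((n:ℝ) + 1) - 2 * √(n:ℝ) := by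
      rw [div_le_iff₀ hx]
      nlinarith [sq_nonneg (√((n:ℝ) + 1) - √(n:ℝ))]
    linarith

lemma wh_mass_term (k : ℕ) (hk : 1 ≤ k) (n N : ℝ) (hn : 0 < n) (hN : n ≤ N) :
    1 / n - 2 * (1 / √n / √N) ≤
      (n ^ (-((k:ℝ) - 1/2)) - N ^ (-((k:ℝ) - 1/2))) ^ 2 * n ^ (2 * k - 2) := by
  have hk' : (1:ℝ) ≤ k := by exact_mod_cast hk
  set a : ℝ := (k:ℝ) - 1/2 with ha
  have hN0 : 0 < N := by linarith
  have e1 : N ^ (-a) = n ^ (-a) * (n / N) ^ a := by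
    rw [Real.div_rpow hn.le hN0.le, Real.rpow_neg hn.le, Real.rpow_neg hN0.le]
    have := (Real.rpow_pos_of_pos hn a).ne'
    field_simp
  have e2 : (n ^ (-a)) ^ 2 * n ^ (2 * k - 2) = 1 / n := by
    rw [← Real.rpow_natCast, ← Real.rpow_mul hn.le, ← Real.rpow_natCast n (2*k-2),
      ← Real.rpow_add hn, one_div, ← Real.rpow_neg_one]
    congr 1
    rw [Nat.cast_sub (by omega)]
    push_cast
    rw [ha]; ring
  have e3 : (n / N) ^ a ≤ √n / √N := by
    rw [← Real.sqrt_div hn.le, Real.sqrt_eq_rpow]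
    apply Real.rpow_le_rpow_of_exponent_ge (by positivity)
    · exact (div_le_one hN0).2 hN
    · linarith
  have e4 : 1 / √n / √N = 1 / n * (√n / √N) := by
    have : 0 < √n := Real.sqrt_pos.2 hn
    have h' : 0 < √N := Real.sqrt_pos.2 hN0
    have hs : √n ^ 2 = n := Real.sq_sqrt hn.le
    field_simp
    linarith
  calc _ = 1 / n * (1 - 2 * (√n / √N)) := by rw [e4]; ring
    _ ≤ 1 / n * (1 - (n / N) ^ a) ^ 2 := by
        gcongr
        nlinarith [sq_nonneg ((n / N) ^ a)]
    _ = _ := by rw [e1, ← e2]; ring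

lemma wh_mass (k : ℕ) (hk : 1 ≤ k) (N : ℕ) (hN : 1 ≤ N) :
    ∑ i ∈ Finset.range N, 1 / ((i:ℝ) + 1) - 4 ≤ ∑ i ∈ Finset.range N,
      (((i:ℝ) + 1) ^ (-((k:ℝ) - 1/2)) - (N:ℝ) ^ (-((k:ℝ) - 1/2))) ^ 2 *
        ((i:ℝ) + 1) ^ (2 * k - 2) := by
  have h1 : ∑ i ∈ Finset.range N, (1 / ((i:ℝ) + 1) - 2 * (1 / √((i:ℝ)+1) / √(N:ℝ))) ≤ _ :=
    Finset.sum_le_sum (fun i hi => wh_mass_term k hk ((i:ℝ) + 1) N (by positivity)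
      (by have := Finset.mem_range.1 hi
          exact_mod_cast this))
  refine le_trans ?_ h1
  rw [Finset.sum_sub_distrib, ← Finset.mul_sum, ← Finset.sum_div]
  have hs : 0 < √(N:ℝ) := Real.sqrt_pos.2 (by exact_mod_cast hN)
  have := (div_le_iff₀ hs).2 (wh_sqrt N)
  linarith

lemma wh_tsum (F : ℤ → ℝ) (N : ℕ) (hF : ∀ n : ℤ, ¬ (1 ≤ n ∧ n ≤ N) → F n = 0) :
    ∑' n : ℤ, F n = ∑ i ∈ Finset.range N, F ((i:ℤ) + 1) := by
  rw [tsum_eq_sum (s := (Finset.range N).image (fun i : ℕ => (i:ℤ) + 1))]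
  · rw [Finset.sum_image]
    intro x _ y _ h
    simpa using h
  · intro n hn
    apply hF
    rintro ⟨h1, h2⟩
    apply hn
    rw [Finset.mem_image]
    refine ⟨(n - 1).toNat, ?_, ?_⟩
    · rw [Finset.mem_range]; omega
    · omega

theorem weighted_hardy_sharp
    (k : ℕ) (hk : 1 ≤ k) (c : ℝ) (hc : c > (2 * (k : ℝ) - 1) ^ 2 / 4) :
    ∃ u : ℤ → ℂ, (Function.support u).Finite ∧ u 0 = 0 ∧
      ∑' n : ℤ, ‖u n - u (n - 1)‖ ^ 2 * ((n : ℝ) - 1 / 2) ^ (2 * k) <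
        c * ∑' n : ℤ, ‖u n‖ ^ 2 * (n : ℝ) ^ (2 * k - 2) := by
  have hk' : (1:ℝ) ≤ k := by exact_mod_cast hk
  obtain ⟨a, ha⟩ : ∃ a : ℝ, a = (k:ℝ) - 1/2 := ⟨_, rfl⟩
  have hca : a ^ 2 < c := by rw [ha]; nlinarith
  have hc0 : 0 < c := lt_of_le_of_lt (sq_nonneg a) hca
  obtain ⟨d, hd⟩ : ∃ d : ℝ, d = (c - a ^ 2) / 2 := ⟨_, rfl⟩
  have hd0 : 0 < d := by linarith
  obtain ⟨M, hM⟩ := wh_limit k a d hd0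
  let g : ℕ → ℝ := fun i => if i = 0 then 1 else
    (((i:ℝ) + 1) ^ (-a) - (i:ℝ) ^ (-a)) ^ 2 * ((i:ℝ) + 1/2) ^ (2*k)
  have hg := wh_sum g (fun i => (a ^ 2 + d) * (1 / ((i:ℝ) + 1))) (M + 1)
    (fun i => by positivity) (fun i hi => by
      have hi0 : i ≠ 0 := by omega
      have hip : (0:ℝ) < i := by exact_mod_cast Nat.pos_of_ne_zero hi0
      simp only [g, if_neg hi0]
      have h1 := wh_diff k hk i hip
      rw [← ha] at h1
      refine h1.trans ?_
      rw [mul_one_div]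
      have := hM i (by omega)
      gcongr)
  obtain ⟨C, hC⟩ : ∃ C : ℝ, C = ∑ i ∈ Finset.range (M + 1), |g i| := ⟨_, rfl⟩
  rw [← hC] at hg
  obtain ⟨N, hN1, hN⟩ : ∃ N : ℕ, 1 ≤ N ∧
      (C + 4 * c) / d < ∑ i ∈ Finset.range N, 1 / ((i:ℝ) + 1) := by
    have h := Real.tendsto_sum_range_one_div_nat_succ_atTop
    obtain ⟨N, hN⟩ := ((Filter.eventually_ge_atTop 1).and
      (h.eventually_gt_atTop ((C + 4 * c) / d))).exists
    exact ⟨N, hN⟩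
  have hmass := wh_mass k hk N hN1
  rw [← ha] at hmass
  obtain ⟨r, hr⟩ : ∃ r : ℤ → ℝ, r = fun n => if 1 ≤ n ∧ n ≤ (N:ℤ) then
    ((n:ℝ) ^ (-a) - (N:ℝ) ^ (-a)) else 0 := ⟨_, rfl⟩
  have hrN : r N = 0 := by rw [hr]; simp
  have hr0 : ∀ n : ℤ, ¬ (1 ≤ n ∧ n ≤ (N:ℤ)) → r n = 0 := by
    intro n hn; rw [hr]; simp only [if_neg hn]
  have hri : ∀ i : ℕ, i < N → r ((i:ℤ) + 1) = ((i:ℝ) + 1) ^ (-a) - (N:ℝ) ^ (-a) := by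
    intro i hi
    rw [hr]
    simp only
    rw [if_pos (by omega)]
    push_cast
    rfl
  refine ⟨fun n => (r n : ℂ), ?_, ?_, ?_⟩
  · apply (Set.finite_Icc (1:ℤ) N).subset
    intro n hn
    by_contra h
    exact hn (by simp only [hr0 n h, Complex.ofReal_zero])
  · simp only [hr0 0 (by omega), Complex.ofReal_zero]
  · have hn1 : ∀ n : ℤ, ‖(r n : ℂ) - (r (n - 1) : ℂ)‖ ^ 2 = (r n - r (n - 1)) ^ 2 := by
      intro n
      rw [← Complex.ofReal_sub, Complex.norm_real, Real.norm_eq_abs, sq_abs]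
    have hn2 : ∀ n : ℤ, ‖(r n : ℂ)‖ ^ 2 = r n ^ 2 := by
      intro n
      rw [Complex.norm_real, Real.norm_eq_abs, sq_abs]
    simp only [hn1, hn2]
    rw [wh_tsum _ N, wh_tsum _ N]
    · have hA : ∑ i ∈ Finset.range N, (r ((i:ℤ)+1) - r ((i:ℤ)+1-1)) ^ 2 *
          ((((i:ℤ)+1 : ℤ) : ℝ) - 1/2) ^ (2*k) ≤ ∑ i ∈ Finset.range N, g i := by
        apply Finset.sum_le_sum
        intro i hi
        have hi' := Finset.mem_range.1 hi
        rw [hri i hi']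
        rcases Nat.eq_zero_or_pos i with h0 | h0
        · subst h0
          have hN' : (1:ℝ) ≤ N := by exact_mod_cast hN1
          have hz : r (((0:ℕ):ℤ) + 1 - 1) = 0 := hr0 _ (by simp)
          rw [hz]
          have hp : 0 < (N:ℝ) ^ (-a) := Real.rpow_pos_of_pos (by linarith) _
          have hl : (N:ℝ) ^ (-a) ≤ 1 := Real.rpow_le_one_of_one_le_of_nonpos hN' (by linarith)
          simp only [g, if_true]
          apply mul_le_one₀
          · simp only [Nat.cast_zero, zero_add, Real.one_rpow, sub_zero]
            nlinarith
          · rw [pow_mul]; positivity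
          · apply pow_le_one₀ <;> norm_num
        · obtain ⟨j, rfl⟩ : ∃ j, i = j + 1 := ⟨i - 1, by omega⟩
          have hj := hri j (by omega)
          have hz : r (((j+1:ℕ):ℤ) + 1 - 1) = (((j+1:ℕ):ℝ)) ^ (-a) - (N:ℝ) ^ (-a) := by
            rw [show ((j+1:ℕ):ℤ) + 1 - 1 = (j:ℤ) + 1 by push_cast; ring, hj]
            push_cast
            rfl
          rw [hz]
          simp only [g, if_neg (Nat.succ_ne_zero j)]
          apply le_of_eq
          push_cast
          ring
      have hB : ∑ i ∈ Finset.range N, r ((i:ℤ)+1) ^ 2 * ((((i:ℤ)+1 : ℤ) : ℝ)) ^ (2*k-2) =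
          ∑ i ∈ Finset.range N, (((i:ℝ) + 1) ^ (-a) - (N:ℝ) ^ (-a)) ^ 2 *
            ((i:ℝ) + 1) ^ (2 * k - 2) := by
        apply Finset.sum_congr rfl
        intro i hi
        rw [hri i (Finset.mem_range.1 hi)]
        push_cast
        rfl
      rw [hB]
      have h1 := hg N
      rw [← Finset.mul_sum] at h1
      rw [div_lt_iff₀ hd0] at hN
      have h2 := mul_le_mul_of_nonneg_left hmass hc0.le
      refine lt_of_le_of_lt (hA.trans h1) (lt_of_lt_of_le ?_ h2)
      have : c = a ^ 2 + 2 * d := by rw [hd]; ring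
      generalize ∑ i ∈ Finset.range N, 1 / ((i:ℝ) + 1) = H at hN
      have e : c * (H - 4) = (a ^ 2 + d) * H + H * d - 4 * c := by
        linear_combination H * this
      linarith
    · intro n hn
      rw [hr0 n hn]; simp
    · intro n hn
      have h1 : r (n - 1) = 0 := by
        by_cases h : n - 1 = N
        · rw [h, hrN]
        · exact hr0 _ (by omega)
      rw [hr0 n hn, h1]; simp
end

section
/- Let m ≥ 1 be a natural number. For every finitely supported function u : ℤ → ℂ with u(n) = 0 for all n ≤ 2m−1 (in particular u vanishes at 0,1,...,2m−1 and on all negative integers), one has ∑_{n=1}^{∞} |(Δ^m u)(n)|² ≥ 2^{2m−3} (2m−1)! · ∑_{n=1}^{∞} |u(n)|²/n^{4m}, where Δ is the discrete Laplacian (Δu)(n) = 2u(n) − u(n+1) − u(n−1) and Δ^m is its m-fold composition. -/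
open scoped BigOperators

/-- The discrete Laplacian `(Δu)(n) = 2u(n) - u(n+1) - u(n-1)`. -/
def discreteLaplacian (u : ℤ → ℂ) : ℤ → ℂ :=
  fun n => 2 * u n - u (n + 1) - u (n - 1)

/-- Forward difference on sequences indexed by `ℕ`. -/
def fwdD (v : ℕ → ℂ) : ℕ → ℂ := fun n => v (n + 1) - v n

lemma bern_aux (t : ℝ) (h0 : 0 ≤ t) (h1 : t ≤ 1) (r : ℕ) :
    (1 + r * t + r * (r + 1) / 2 * t ^ 2) * (1 - t) ^ r ≤ 1 := by
  induction r with
  | zero => simp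
  | succ r ih =>
    refine le_trans ?_ ih
    rw [pow_succ' (1 - t) r, ← mul_assoc]
    apply mul_le_mul_of_nonneg_right _ (pow_nonneg (by linarith) r)
    push_cast
    have : 0 ≤ ((r : ℝ) + 1) * (r + 2) / 2 * t ^ 3 := by positivity
    nlinarith [this]

lemma bern_aux2 (n r : ℕ) :
    (((n : ℝ) + 1) ^ 2 + r * (n + 1) + r * (r + 1) / 2) * (n : ℝ) ^ r
      ≤ ((n : ℝ) + 1) ^ (r + 2) := by
  have hn : (0 : ℝ) < (n : ℝ) + 1 := by positivity
  have h := bern_aux (1 / ((n : ℝ) + 1)) (by positivity)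
    (by rw [div_le_one hn]; linarith [(Nat.cast_nonneg n : (0 : ℝ) ≤ n)]) r
  have e : 1 - 1 / ((n : ℝ) + 1) = n / (n + 1) := by field_simp; ring
  rw [e, div_pow (n : ℝ) ((n : ℝ) + 1) r] at h
  have h2 := mul_le_mul_of_nonneg_right h (pow_pos hn (r + 2)).le
  have e2 : (1 + r * (1 / ((n : ℝ) + 1)) + r * (r + 1) / 2 * (1 / ((n : ℝ) + 1)) ^ 2) *
      ((n : ℝ) ^ r / ((n : ℝ) + 1) ^ r) * ((n : ℝ) + 1) ^ (r + 2) =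
      (((n : ℝ) + 1) ^ 2 + r * (n + 1) + r * (r + 1) / 2) * (n : ℝ) ^ r := by
    rw [pow_add]; field_simp
  rw [e2] at h2
  linarith

lemma weight_aux (n j : ℕ) (hn : 1 ≤ n) (α : ℝ) (hα : α = j + 1 / 2) :
    α / ((n : ℝ) + 1) ^ (2 * j + 1) + α ^ 2 / ((n : ℝ) + 1) ^ (2 * j + 2)
      ≤ α / (n + α) / (n : ℝ) ^ (2 * j) := by
  have hn0 : (0 : ℝ) < n := by exact_mod_cast hn
  have hj : (0 : ℝ) ≤ j := Nat.cast_nonneg j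
  have hα0 : 0 < α := by rw [hα]; positivity
  have hb := bern_aux2 n (2 * j)
  have hP : (0 : ℝ) < (n : ℝ) ^ (2 * j) := by positivity
  have e : α / ((n : ℝ) + 1) ^ (2 * j + 1) + α ^ 2 / ((n : ℝ) + 1) ^ (2 * j + 2)
      = α * (n + 1 + α) / ((n : ℝ) + 1) ^ (2 * j + 2) := by
    rw [pow_succ ((n : ℝ) + 1) (2 * j + 1)]; field_simp
  rw [e, div_div, div_le_div_iff₀ (by positivity) (by positivity)]
  have key : (n + 1 + α) * ((n : ℝ) + α) ≤
      ((n : ℝ) + 1) ^ 2 + (2 * j : ℕ) * (n + 1) + (2 * j : ℕ) * ((2 * j : ℕ) + 1) / 2 := by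
    push_cast; rw [hα]; nlinarith [mul_nonneg hj hj]
  have h3 := mul_le_mul_of_nonneg_right key hP.le
  calc α * (n + 1 + α) * ((n + α) * (n : ℝ) ^ (2 * j))
      = α * ((n + 1 + α) * ((n : ℝ) + α) * (n : ℝ) ^ (2 * j)) := by ring
    _ ≤ α * ((n : ℝ) + 1) ^ (2 * j + 2) :=
      mul_le_mul_of_nonneg_left (h3.trans hb) hα0.le

lemma sq_aux (n : ℕ) (hn : 1 ≤ n) (α : ℝ) (hα : 0 < α) (a b : ℂ) :
    α / (n + α) * ‖a‖ ^ 2 - α / n * ‖b‖ ^ 2 ≤ ‖a - b‖ ^ 2 := by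
  have hn0 : (0 : ℝ) < n := by exact_mod_cast hn
  have h1 : (‖a‖ - ‖b‖) ^ 2 ≤ ‖a - b‖ ^ 2 := by
    rw [← sq_abs (‖a‖ - ‖b‖)]
    exact pow_le_pow_left₀ (abs_nonneg _) (abs_norm_sub_norm_le a b) 2
  refine le_trans ?_ h1
  have e : (‖a‖ - ‖b‖) ^ 2 - (α / (n + α) * ‖a‖ ^ 2 - α / n * ‖b‖ ^ 2)
      = (n * ‖a‖ - (n + α) * ‖b‖) ^ 2 / (n * (n + α)) := by
    field_simp; ring
  have : 0 ≤ (n * ‖a‖ - (n + α) * ‖b‖) ^ 2 / (n * (n + α)) := by positivity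
  linarith

lemma point_aux (v : ℕ → ℂ) (j : ℕ) (hv : ∀ n, n < j + 1 → v n = 0) (n : ℕ)
    (α : ℝ) (hα : α = j + 1 / 2) :
    α * ‖v (n + 1)‖ ^ 2 / ((n + 1 : ℕ) : ℝ) ^ (2 * j + 1) - α * ‖v n‖ ^ 2 / (n : ℝ) ^ (2 * j + 1)
      + α ^ 2 * (‖v (n + 1)‖ ^ 2 / ((n + 1 : ℕ) : ℝ) ^ (2 * (j + 1)))
      ≤ ‖fwdD v n‖ ^ 2 / (n : ℝ) ^ (2 * j) := by
  have hα0 : 0 < α := by rw [hα]; positivity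
  rcases Nat.eq_zero_or_pos n with rfl | hn
  · have hv0 : v 0 = 0 := hv 0 (by omega)
    rcases Nat.eq_zero_or_pos j with rfl | hj
    · simp [fwdD, hv0, hα]
      nlinarith [sq_nonneg ‖v 1‖]
    · have hv1 : v 1 = 0 := hv 1 (by omega)
      simp [fwdD, hv0, hv1]
  · have hn0 : (0 : ℝ) < n := by exact_mod_cast hn
    have hw := mul_le_mul_of_nonneg_right (weight_aux n j hn α hα) (sq_nonneg ‖v (n + 1)‖)
    have hs := div_le_div_of_nonneg_right (sq_aux n hn α hα0 (v (n + 1)) (v n))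
      (pow_pos hn0 (2 * j)).le
    have e : (α / (n + α) * ‖v (n + 1)‖ ^ 2 - α / n * ‖v n‖ ^ 2) / (n : ℝ) ^ (2 * j)
      = α / (n + α) / (n : ℝ) ^ (2 * j) * ‖v (n + 1)‖ ^ 2
        - α * ‖v n‖ ^ 2 / (n : ℝ) ^ (2 * j + 1) := by
      rw [pow_succ]; field_simp; ring
    rw [e] at hs
    have e2 : 2 * (j + 1) = 2 * j + 2 := by ring
    rw [e2]
    push_cast
    unfold fwdD
    refine le_trans (le_of_eq ?_) ((sub_le_sub_right hw _).trans hs)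
    ring

lemma step_aux (v : ℕ → ℂ) (j N : ℕ) (hv : ∀ n, n < j + 1 → v n = 0)
    (hN : ∀ n, N ≤ n → v n = 0) :
    ((j : ℝ) + 1 / 2) ^ 2 * ∑ n ∈ Finset.range N, ‖v n‖ ^ 2 / (n : ℝ) ^ (2 * (j + 1))
      ≤ ∑ n ∈ Finset.range N, ‖fwdD v n‖ ^ 2 / (n : ℝ) ^ (2 * j) := by
  have h := Finset.sum_le_sum (fun n (_ : n ∈ Finset.range N) =>
    point_aux v j hv n ((j : ℝ) + 1 / 2) rfl)
  refine le_trans (le_of_eq ?_) h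
  rw [Finset.sum_add_distrib,
    Finset.sum_range_sub (fun n : ℕ => ((j : ℝ) + 1 / 2) * ‖v n‖ ^ 2 / (n : ℝ) ^ (2 * j + 1)),
    ← Finset.mul_sum]
  have h1 := Finset.sum_range_succ (fun n : ℕ => ‖v n‖ ^ 2 / (n : ℝ) ^ (2 * (j + 1))) N
  have h2 := Finset.sum_range_succ' (fun n : ℕ => ‖v n‖ ^ 2 / (n : ℝ) ^ (2 * (j + 1))) N
  rw [h1] at h2
  simp only [hN N le_rfl, hv 0 (by omega), norm_zero] at h2 ⊢
  simp at h2 ⊢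
  left
  exact h2

lemma iter_aux (N k : ℕ) : ∀ v : ℕ → ℂ, (∀ n, n < k → v n = 0) → (∀ n, N ≤ n → v n = 0) →
    (∏ i ∈ Finset.range k, ((i : ℝ) + 1 / 2) ^ 2) *
      ∑ n ∈ Finset.range N, ‖v n‖ ^ 2 / (n : ℝ) ^ (2 * k)
      ≤ ∑ n ∈ Finset.range N, ‖fwdD^[k] v n‖ ^ 2 := by
  induction k with
  | zero => intro v _ _; simp
  | succ k ih =>
    intro v hv hN
    have h1 := ih (fwdD v) (fun n hn => by simp [fwdD, hv n (by omega), hv (n + 1) (by omega)])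
      (fun n hn => by simp [fwdD, hN n hn, hN (n + 1) (by omega)])
    have h2 := step_aux v k N hv hN
    rw [Function.iterate_succ_apply, Finset.prod_range_succ, mul_assoc]
    refine le_trans (mul_le_mul_of_nonneg_left h2 ?_) h1
    exact Finset.prod_nonneg (fun i _ => sq_nonneg _)

lemma const_aux (m : ℕ) :
    (2 : ℝ) ^ (2 * ((m + 1 : ℕ) : ℤ) - 3) * (Nat.factorial (2 * (m + 1) - 1)) ≤
      ∏ i ∈ Finset.range (2 * (m + 1)), ((i : ℝ) + 1 / 2) ^ 2 := by
  induction m with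
  | zero => norm_num [Finset.prod_range_succ]
  | succ m ih =>
    have e1 : 2 * (m + 1 + 1) = 2 * (m + 1) + 1 + 1 := by ring
    have e2 : 2 * (m + 1 + 1) - 1 = 2 * (m + 1) - 1 + 1 + 1 := by omega
    have e3 : 2 * ((m + 1 + 1 : ℕ) : ℤ) - 3 = (2 * ((m + 1 : ℕ) : ℤ) - 3) + 2 := by
      push_cast; ring
    rw [e2, e1, Finset.prod_range_succ, Finset.prod_range_succ, e3,
      zpow_add₀ (by norm_num), Nat.factorial_succ, Nat.factorial_succ]
    have e4 : 2 * (m + 1) - 1 + 1 = 2 * (m + 1) := by omega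
    rw [e4, mul_assoc (∏ i ∈ Finset.range (2 * (m + 1)), ((i : ℝ) + 1 / 2) ^ 2)]
    have hm : (0 : ℝ) ≤ m := Nat.cast_nonneg m
    have hk : 4 * (((2 * (m + 1) : ℕ) : ℝ) + 1) * ((2 * (m + 1) : ℕ) : ℝ) ≤
        (((2 * (m + 1) : ℕ) : ℝ) + 1 / 2) ^ 2 * (((2 * (m + 1) + 1 : ℕ) : ℝ) + 1 / 2) ^ 2 := by
      push_cast
      rw [← mul_pow, sq, mul_assoc 4]
      apply mul_le_mul <;> nlinarith [mul_nonneg hm hm]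
    refine le_trans (le_of_eq ?_) (mul_le_mul ih hk (by positivity)
      (Finset.prod_nonneg (fun i _ => sq_nonneg _)))
    push_cast
    norm_num
    ring

lemma lap_fwd (m : ℕ) : ∀ (u : ℤ → ℂ) (n : ℕ),
    ‖(discreteLaplacian^[m] u) ((n : ℤ) + m)‖ = ‖fwdD^[2 * m] (fun k : ℕ => u k) n‖ := by
  have key : ∀ (u : ℤ → ℂ) (n : ℕ), fwdD^[2 * m] (fun k : ℕ => u k) n =
      (-1) ^ m * (discreteLaplacian^[m] u) ((n : ℤ) + m) := by
    intro u
    induction m with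
    | zero => intro n; simp
    | succ m ih =>
      intro n
      have e : 2 * (m + 1) = (2 * m + 1) + 1 := by ring
      rw [e, Function.iterate_succ_apply', Function.iterate_succ_apply',
        Function.iterate_succ_apply']
      simp only [fwdD, discreteLaplacian]
      rw [ih, ih, ih]
      push_cast
      have a1 : (n : ℤ) + 1 + 1 + m = n + (m + 1) + 1 := by ring
      have a2 : (n : ℤ) + 1 + m = n + (m + 1) := by ring
      have a3 : (n : ℤ) + m = n + (m + 1) - 1 := by ring
      rw [a1, a2, a3]
      ring
  intro u n
  rw [key u n]
  simp

lemma lap_supp (m : ℕ) (u : ℤ → ℂ) (hu : (Function.support u).Finite) :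
    (Function.support (discreteLaplacian^[m] u)).Finite := by
  induction m with
  | zero => simpa using hu
  | succ m ih =>
    rw [Function.iterate_succ_apply']
    set w := discreteLaplacian^[m] u
    refine ((ih.union (ih.image (fun x => x - 1))).union (ih.image (fun x => x + 1))).subset ?_
    intro n hn
    by_contra hc
    simp only [Set.mem_union, Set.mem_image, Function.mem_support, not_or, not_exists, not_and] at hc
    obtain ⟨⟨c1, c2⟩, c3⟩ := hc
    apply hn
    have d1 : w n = 0 := not_not.mp c1
    have d2 : w (n + 1) = 0 := by
      by_contra h; exact c2 (n + 1) h (by ring)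
    have d3 : w (n - 1) = 0 := by
      by_contra h; exact c3 (n - 1) h (by ring)
    simp [discreteLaplacian, d1, d2, d3]

theorem higher_order_hardy_even
    (m : ℕ) (hm : 1 ≤ m) (u : ℤ → ℂ)
    (hu : (Function.support u).Finite)
    (h0 : ∀ n : ℤ, n ≤ 2 * (m : ℤ) - 1 → u n = 0) :
    ∑' n : ℕ, ‖(discreteLaplacian^[m] u) ((n : ℤ) + 1)‖ ^ 2 ≥
      (2 : ℝ) ^ (2 * (m : ℤ) - 3) * (Nat.factorial (2 * m - 1)) *
        ∑' n : ℕ, ‖u ((n : ℤ) + 1)‖ ^ 2 / ((n : ℝ) + 1) ^ (4 * m) := by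
  obtain ⟨p, rfl⟩ : ∃ p, m = p + 1 := ⟨m - 1, by omega⟩
  -- a bound for the support
  obtain ⟨N, hN⟩ : ∃ N : ℕ, ∀ n : ℕ, N ≤ n → u n = 0 := by
    obtain ⟨B, hB⟩ := hu.bddAbove
    refine ⟨(B + 1).toNat, fun n hn => ?_⟩
    by_contra h
    have : (n : ℤ) ≤ B := hB h
    omega
  have hR : ∑' n : ℕ, ‖u ((n : ℤ) + 1)‖ ^ 2 / ((n : ℝ) + 1) ^ (4 * (p + 1)) =
      ∑ n ∈ Finset.range N, ‖u (n : ℤ)‖ ^ 2 / (n : ℝ) ^ (2 * (2 * (p + 1))) := by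
    rw [tsum_eq_sum (s := Finset.range N)]
    · have h1 := Finset.sum_range_succ
        (fun n : ℕ => ‖u (n : ℤ)‖ ^ 2 / (n : ℝ) ^ (2 * (2 * (p + 1)))) N
      have h2 := Finset.sum_range_succ'
        (fun n : ℕ => ‖u (n : ℤ)‖ ^ 2 / (n : ℝ) ^ (2 * (2 * (p + 1)))) N
      have hu0 : u ((0 : ℕ) : ℤ) = 0 := h0 _ (by push_cast; omega)
      rw [h1] at h2
      simp only [hN N le_rfl, hu0, norm_zero] at h2
      norm_num at h2
      rw [h2]
      refine Finset.sum_congr rfl (fun n _ => ?_)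
      congr 2
      ring
    · intro n hn
      have : u ((n : ℤ) + 1) = 0 := by
        have := hN (n + 1) (by simp at hn; omega)
        push_cast at this; exact this
      simp [this]
  rw [hR]
  have hI := iter_aux N (2 * (p + 1)) (fun k : ℕ => u k)
    (fun n hn => h0 _ (by push_cast; omega)) hN
  have hS : Summable (fun n : ℕ => ‖(discreteLaplacian^[p + 1] u) ((n : ℤ) + 1)‖ ^ 2) := by
    apply summable_of_hasFiniteSupport
    have hinj : Set.InjOn (fun n : ℕ => (n : ℤ) + 1)
        ((fun n : ℕ => (n : ℤ) + 1) ⁻¹' Function.support (discreteLaplacian^[p + 1] u)) := by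
      intro a _ b _ h
      simpa using h
    refine ((lap_supp (p + 1) u hu).preimage hinj).subset ?_
    intro n hn hc
    apply hn
    simp only [] at hc
    simp [hc]
  have hL : ∑ n ∈ Finset.range N, ‖fwdD^[2 * (p + 1)] (fun k : ℕ => u k) n‖ ^ 2 ≤
      ∑' n : ℕ, ‖(discreteLaplacian^[p + 1] u) ((n : ℤ) + 1)‖ ^ 2 := by
    have h3 := hS.sum_le_tsum ((Finset.range N).map (addRightEmbedding p))
      (fun n _ => sq_nonneg _)
    refine le_trans (le_of_eq ?_) h3
    rw [Finset.sum_map]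
    refine Finset.sum_congr rfl (fun n _ => ?_)
    rw [← lap_fwd (p + 1) u n]
    simp only [addRightEmbedding_apply]
    push_cast
    rw [add_assoc]
  refine ge_iff_le.mpr (le_trans ?_ (hI.trans hL))
  exact mul_le_mul_of_nonneg_right (const_aux p) (Finset.sum_nonneg (fun n _ => by positivity))
end
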